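/- arXiv:2008.06736 — 2 statements merged into one kernel-verified Lean document; each statement's English description precedes it below -/
import Mathlib

section
/- In the setting of the averaged preconditioned gradient-descent scheme for the quadratic loss L(w) = ½wᵀΣw − aᵀw with symmetric Σ and symmetric positive definite preconditioner Q satisfying αQ ⪯ Σ ⪯ βQ for 0 < α ≤ β, assume additionally η ≤ η_k < 1/β for some η > 0, γ_k = η_k/(1+λη_k), and set γ = η/(1+λη). Then: (i) w_k converges to Σ^{−1}a and ŵ_k converges to (Σ + λQ)^{−1}a as k → ∞; (ii) there exists a constant M > 0 such that for all k, ‖ŵ_k − w̃_k‖₂ ≤ M (1 − λγ)^k. -/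
lemma pgd_coercive {E : Type*} [NormedAddCommGroup E] [InnerProductSpace ℝ E]
    [FiniteDimensional ℝ E] (Q V : E →ₗ[ℝ] E) (hQV : ∀ x, Q (V x) = x)
    (hQ : Q.IsSymmetric) (hQpos : ∀ x, 0 ≤ inner ℝ (Q x) x) :
    ∃ C : ℝ, 0 < C ∧ ∀ x, ‖x‖ ^ 2 ≤ C * inner ℝ (Q x) x := by
  set V' := LinearMap.toContinuousLinearMap V with hV'
  refine ⟨‖V'‖ + 1, by positivity, fun x => ?_⟩
  set C := ‖V'‖ + 1 with hC
  have hCpos : 0 < C := by positivity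
  have hVx : inner ℝ x (V x) ≤ C * ‖x‖ ^ 2 := by
    have h1 : inner ℝ x (V x) ≤ ‖x‖ * ‖V x‖ := real_inner_le_norm _ _
    have h2 : ‖V x‖ ≤ ‖V'‖ * ‖x‖ := V'.le_opNorm x
    have h3 : ‖V'‖ ≤ C := by linarith
    nlinarith [norm_nonneg x, mul_le_mul_of_nonneg_left h2 (norm_nonneg x), sq_nonneg ‖x‖]
  have h := hQpos (C • x - V x)
  have e : inner ℝ (Q (C • x - V x)) (C • x - V x)
      = C ^ 2 * inner ℝ (Q x) x - 2 * C * ‖x‖ ^ 2 + inner ℝ x (V x) := by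
    have h1 : inner ℝ (Q x) (V x) = ‖x‖ ^ 2 := by
      rw [hQ x (V x), hQV, real_inner_self_eq_norm_sq]
    simp only [map_sub, map_smul, hQV, inner_sub_left, inner_sub_right, inner_smul_left,
      inner_smul_right, h1, real_inner_self_eq_norm_sq]
    simp
    ring
  rw [e] at h
  have : 0 ≤ C * (C * inner ℝ (Q x) x - ‖x‖ ^ 2) := by nlinarith
  have := nonneg_of_mul_nonneg_right this hCpos
  linarith

lemma pgd_contract {E : Type*} [NormedAddCommGroup E] [InnerProductSpace ℝ E]
    (S Q V : E →ₗ[ℝ] E) (hQV : ∀ x, Q (V x) = x)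
    (hQ : Q.IsSymmetric) (hS : S.IsSymmetric) (hQpos : ∀ x, 0 ≤ inner ℝ (Q x) x)
    (α β η : ℝ) (hα : 0 < α) (hβ : 0 < β) (hη : 0 < η) (hηβ : η * β ≤ 1)
    (hlow : ∀ x, α * inner ℝ (Q x) x ≤ inner ℝ (S x) x)
    (hup : ∀ x, inner ℝ (S x) x ≤ β * inner ℝ (Q x) x) (x : E) :
    inner ℝ (Q (x - η • V (S x))) (x - η • V (S x)) ≤ (1 - η * α) * inner ℝ (Q x) x := by
  set y := V (S x) with hy
  have hQy : Q y = S x := hQV _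
  have h1 : inner ℝ (S x) y = inner ℝ (Q y) y := by rw [hQy]
  have h2 : inner ℝ (Q x) y = inner ℝ (S x) x := by
    rw [hQ x y, hQy, real_inner_comm]
  have h3 : inner ℝ (S y) x = inner ℝ (Q y) y := by
    rw [hS y x, real_inner_comm, h1]
  have hSpos : ∀ z, 0 ≤ inner ℝ (S z) z := fun z =>
    le_trans (mul_nonneg hα.le (hQpos z)) (hlow z)
  have h4 : inner ℝ (Q y) y ≤ β * inner ℝ (S x) x := by
    have h := hSpos (β • x - y)
    have e : inner ℝ (S (β • x - y)) (β • x - y)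
        = β ^ 2 * inner ℝ (S x) x - 2 * β * inner ℝ (Q y) y + inner ℝ (S y) y := by
      simp only [map_sub, map_smul, inner_sub_left, inner_sub_right, inner_smul_left,
        inner_smul_right, h1, h3]
      simp
      ring
    rw [e] at h
    have := hup y
    have : 0 ≤ β * (β * inner ℝ (S x) x - inner ℝ (Q y) y) := by nlinarith
    have := nonneg_of_mul_nonneg_right this hβ
    linarith
  have e : inner ℝ (Q (x - η • y)) (x - η • y)
      = inner ℝ (Q x) x - 2 * η * inner ℝ (S x) x + η ^ 2 * inner ℝ (Q y) y := by
    simp only [map_sub, map_smul, inner_sub_left, inner_sub_right, inner_smul_left,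
      inner_smul_right, h2]
    rw [hQy, h1, hQy]
    simp
    ring
  rw [e]
  have h5 : η ^ 2 * inner ℝ (Q y) y ≤ η * inner ℝ (S x) x := by
    have := mul_le_mul_of_nonneg_left h4 (sq_nonneg η)
    have := mul_le_mul_of_nonneg_right hηβ (mul_nonneg hη.le (hSpos x))
    nlinarith
  have := mul_le_mul_of_nonneg_left (hlow x) hη.le
  nlinarith

lemma pgd_tendsto {E : Type*} [NormedAddCommGroup E] [InnerProductSpace ℝ E]
    [FiniteDimensional ℝ E]
    (S Q V : E →ₗ[ℝ] E) (hQV : ∀ x, Q (V x) = x)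
    (hQ : Q.IsSymmetric) (hS : S.IsSymmetric) (hQpos : ∀ x, 0 ≤ inner ℝ (Q x) x)
    (α β η₀ : ℝ) (hα : 0 < α) (hαβ : α ≤ β) (hη₀ : 0 < η₀)
    (η r : ℕ → ℝ) (hη : ∀ k, η₀ ≤ η k) (hηβ : ∀ k, η k * β ≤ 1)
    (hr0 : ∀ k, 0 ≤ r k) (hr1 : ∀ k, r k ≤ 1)
    (hlow : ∀ x, α * inner ℝ (Q x) x ≤ inner ℝ (S x) x)
    (hup : ∀ x, inner ℝ (S x) x ≤ β * inner ℝ (Q x) x)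
    (e : ℕ → E) (he : ∀ k, e (k + 1) = r k • (e k - η k • V (S (e k)))) :
    Filter.Tendsto e Filter.atTop (nhds 0) := by
  obtain ⟨C, hC, hCQ⟩ := pgd_coercive Q V hQV hQ hQpos
  have hβ : 0 < β := hα.trans_le hαβ
  have hq0 : 0 ≤ 1 - η₀ * α := by
    have := hηβ 0
    have := hη 0
    nlinarith
  have hq1 : 1 - η₀ * α < 1 := by nlinarith
  have hN : ∀ k, inner ℝ (Q (e k)) (e k) ≤ (1 - η₀ * α) ^ k * inner ℝ (Q (e 0)) (e 0) := by
    intro k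
    induction k with
    | zero => simp
    | succ k ih =>
      have h1 := pgd_contract S Q V hQV hQ hS hQpos α β (η k) hα hβ (hη₀.trans_le (hη k))
        (hηβ k) hlow hup (e k)
      have h0 := hQpos (e k - η k • V (S (e k)))
      rw [he k]
      set z := e k - η k • V (S (e k)) with hz
      have h2 : inner ℝ (Q (r k • z)) (r k • z) = (r k) ^ 2 * inner ℝ (Q z) z := by
        simp only [map_smul, inner_smul_left, inner_smul_right]
        simp
        ring
      rw [h2]
      have h3 : (r k) ^ 2 ≤ 1 := pow_le_one₀ (hr0 k) (hr1 k)
      have h4 : (1 - η k * α) * inner ℝ (Q (e k)) (e k)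
          ≤ (1 - η₀ * α) * inner ℝ (Q (e k)) (e k) := by
        apply mul_le_mul_of_nonneg_right _ (hQpos _)
        have := hη k
        nlinarith
      calc (r k) ^ 2 * inner ℝ (Q z) z ≤ 1 * inner ℝ (Q z) z :=
            mul_le_mul_of_nonneg_right h3 h0
        _ ≤ (1 - η₀ * α) * inner ℝ (Q (e k)) (e k) := by linarith
        _ ≤ (1 - η₀ * α) * ((1 - η₀ * α) ^ k * inner ℝ (Q (e 0)) (e 0)) :=
            mul_le_mul_of_nonneg_left ih hq0
        _ = _ := by ring
  have hlim : Filter.Tendsto (fun k => C * ((1 - η₀ * α) ^ k * inner ℝ (Q (e 0)) (e 0)))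
      Filter.atTop (nhds 0) := by
    have := ((tendsto_pow_atTop_nhds_zero_of_lt_one hq0 hq1).mul_const
      (inner ℝ (Q (e 0)) (e 0))).const_mul C
    simpa using this
  have hsq : Filter.Tendsto (fun k => ‖e k‖ ^ 2) Filter.atTop (nhds 0) :=
    squeeze_zero (fun k => by positivity)
      (fun k => (hCQ (e k)).trans (mul_le_mul_of_nonneg_left (hN k) hC.le)) hlim
  rw [tendsto_zero_iff_norm_tendsto_zero]
  have := hsq.sqrt
  simpa [Real.sqrt_sq] using this

/-- The algebraic identity relating the regularized path to the averaged path. -/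
lemma pgd_identity {E : Type*} [AddCommGroup E] [Module ℝ E]
    (A : E →ₗ[ℝ] E) (b : E) (lam : ℝ) (η γ r R : ℕ → ℝ)
    (hγ : ∀ k, γ k = r k * η k) (hr : ∀ k, r k = 1 - lam * γ k)
    (hR0 : R 0 = 1) (hR : ∀ k, R (k + 1) = R k * r k)
    (w what : ℕ → E) (hw0 : w 0 = 0) (hwhat0 : what 0 = 0)
    (hw : ∀ k, w (k + 1) = w k - η k • (A (w k) - b))
    (hwhat : ∀ k, what (k + 1) = what k - γ k • (A (what k) + lam • what k - b)) (k : ℕ) :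
    what k = ∑ i ∈ Finset.range k, (R i - R (i + 1)) • w i + R k • w k := by
  have hG : ∀ k, A (what k) + lam • what k - b = R k • (A (w k) - b) := by
    intro k
    induction k with
    | zero => simp [hw0, hwhat0, hR0]
    | succ k ih =>
      have h1 : A (what (k + 1)) + lam • what (k + 1) - b
          = (A (what k) + lam • what k - b) - γ k • (A (A (what k) + lam • what k - b)
            + lam • (A (what k) + lam • what k - b)) := by
        rw [hwhat k]
        simp only [map_sub, map_smul, map_add]
        module
      rw [h1, ih, hw k, hR k]
      simp only [map_sub, map_smul]
      rw [hγ k]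
      have : r k = 1 - lam * (r k * η k) := by rw [← hγ k]; exact hr k
      generalize A (w k) = u
      match_scalars
      · linear_combination (-R k) * this
      · linear_combination (R k) * this
      all_goals linear_combination 0 * this
  induction k with
  | zero => simp [hw0, hwhat0]
  | succ k ih =>
    rw [hwhat k, hG k, Finset.sum_range_succ, hw k, hR k, hγ k]
    nth_rw 1 [ih]
    module


/-- Theorem 3 (PSGD), part 2, expectation form: convergence of the preconditioned GD
paths and geometric convergence of the averaged path to the regularized path,
under `αQ ⪯ Σ ⪯ βQ`. -/
theorem averaged_pgd_convergence
    (d : ℕ) (S : Matrix (Fin d) (Fin d) ℝ) (hSsymm : S.IsSymm)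
    (Q : Matrix (Fin d) (Fin d) ℝ) (hQ : Q.PosDef)
    (α β : ℝ) (hα : 0 < α) (hαβ : α ≤ β)
    (hlower : (S - α • Q).PosSemidef)
    (hupper : ((β • Q) - S).PosSemidef)
    (a : EuclideanSpace ℝ (Fin d)) (lam : ℝ) (hlam : 0 < lam)
    (η₀ : ℝ) (hη₀ : 0 < η₀)
    (η γ : ℕ → ℝ) (hηlb : ∀ k, η₀ ≤ η k) (hηub : ∀ k, η k < 1 / β)
    (hγk : ∀ k, γ k = η k / (1 + lam * η k))
    (γ₀ : ℝ) (hγ₀ : γ₀ = η₀ / (1 + lam * η₀))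
    (w what : ℕ → EuclideanSpace ℝ (Fin d))
    (hw0 : w 0 = 0) (hwhat0 : what 0 = 0)
    (hw : ∀ k, w (k + 1)
      = w k - η k • Matrix.toEuclideanLin Q⁻¹ (Matrix.toEuclideanLin S (w k) - a))
    (hwhat : ∀ k, what (k + 1)
      = what k - γ k • Matrix.toEuclideanLin Q⁻¹
          (Matrix.toEuclideanLin (S + lam • Q) (what k) - a))
    (P p : ℕ → ℝ)
    (hP : ∀ k, P k = 1 - ∏ i ∈ Finset.range (k + 1), (γ i / η i))
    (hp0 : p 0 = P 0) (hps : ∀ k, p (k + 1) = P (k + 1) - P k)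
    (wtil : ℕ → EuclideanSpace ℝ (Fin d))
    (hwtil : ∀ k, wtil k = (P k)⁻¹ • ∑ i ∈ Finset.range (k + 1), p i • w i) :
    Filter.Tendsto w Filter.atTop (nhds (Matrix.toEuclideanLin S⁻¹ a)) ∧
    Filter.Tendsto what Filter.atTop (nhds (Matrix.toEuclideanLin (S + lam • Q)⁻¹ a)) ∧
    (∃ M : ℝ, 0 < M ∧ ∀ k, ‖what k - wtil k‖ ≤ M * (1 - lam * γ₀) ^ k) := by
  have hβ : 0 < β := hα.trans_le hαβ
  have hηpos : ∀ k, 0 < η k := fun k => hη₀.trans_le (hηlb k)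
  have hηβ : ∀ k, η k * β ≤ 1 := fun k => by
    have := (lt_div_iff₀ hβ).1 (hηub k)
    linarith
  -- matrix facts
  have hinv : ∀ M : Matrix (Fin d) (Fin d) ℝ, M.PosDef → ∀ x,
      Matrix.toEuclideanLin M (Matrix.toEuclideanLin M⁻¹ x) = x := by
    intro M hM x
    have hdet : IsUnit M.det := (Matrix.isUnit_iff_isUnit_det M).1 hM.isUnit
    simp [Matrix.toEuclideanLin_apply, Matrix.mulVec_mulVec, Matrix.mul_nonsing_inv _ hdet]
  have hinv' : ∀ M : Matrix (Fin d) (Fin d) ℝ, M.PosDef → ∀ x,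
      Matrix.toEuclideanLin M⁻¹ (Matrix.toEuclideanLin M x) = x := by
    intro M hM x
    have hdet : IsUnit M.det := (Matrix.isUnit_iff_isUnit_det M).1 hM.isUnit
    simp [Matrix.toEuclideanLin_apply, Matrix.mulVec_mulVec, Matrix.nonsing_inv_mul _ hdet]
  have hSpd : S.PosDef := by
    have := Matrix.PosDef.posSemidef_add hlower (hQ.smul hα)
    simpa using this
  have hSQpd : (S + lam • Q).PosDef := hSpd.add (hQ.smul hlam)
  have hnn : ∀ M : Matrix (Fin d) (Fin d) ℝ, M.PosSemidef → ∀ x,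
      0 ≤ inner ℝ (Matrix.toEuclideanLin M x) x := by
    intro M hM x
    exact (Matrix.isPositive_toEuclideanLin_iff.2 hM).re_inner_nonneg_left x
  have hsymS : (Matrix.toEuclideanLin S).IsSymmetric :=
    Matrix.isSymmetric_toEuclideanLin_iff.2 hSpd.isHermitian
  have hsymQ : (Matrix.toEuclideanLin Q).IsSymmetric :=
    Matrix.isSymmetric_toEuclideanLin_iff.2 hQ.isHermitian
  have hlow : ∀ x, α * inner ℝ (Matrix.toEuclideanLin Q x) x
      ≤ inner ℝ (Matrix.toEuclideanLin S x) x := by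
    intro x
    have := hnn _ hlower x
    simp only [map_sub, map_smul, LinearMap.sub_apply, LinearMap.smul_apply, inner_sub_left,
      real_inner_smul_left] at this
    linarith
  have hup : ∀ x, inner ℝ (Matrix.toEuclideanLin S x) x
      ≤ β * inner ℝ (Matrix.toEuclideanLin Q x) x := by
    intro x
    have := hnn _ hupper x
    simp only [map_sub, map_smul, LinearMap.sub_apply, LinearMap.smul_apply, inner_sub_left,
      real_inner_smul_left] at this
    linarith
  have hQV := hinv Q hQ
  have hVQ := hinv' Q hQ
  have hQpos := hnn Q hQ.posSemidef
  have hu := hinv S hSpd a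
  have hv := hinv _ hSQpd a
  have hadd : ∀ x, Matrix.toEuclideanLin (S + lam • Q) x
      = Matrix.toEuclideanLin S x + lam • Matrix.toEuclideanLin Q x := by
    intro x; simp only [map_add, map_smul, LinearMap.add_apply, LinearMap.smul_apply]
  rw [hadd] at hv
  simp only [hadd] at hwhat
  generalize Matrix.toEuclideanLin S⁻¹ a = u at *
  generalize Matrix.toEuclideanLin (S + lam • Q)⁻¹ a = v at *
  generalize Matrix.toEuclideanLin S = T at *
  generalize Matrix.toEuclideanLin Q⁻¹ = V at *
  generalize Matrix.toEuclideanLin Q = K at *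
  -- the ratios
  set r : ℕ → ℝ := fun k => γ k / η k with hrdef
  have hden : ∀ k, 0 < 1 + lam * η k := fun k => by have := hηpos k; positivity
  have hden0 : 0 < 1 + lam * η₀ := by positivity
  have hr' : ∀ k, r k = 1 / (1 + lam * η k) := fun k => by
    have h1 := (hηpos k).ne'
    have h2 := (hden k).ne'
    simp only [hrdef, hγk k]
    field_simp
  have hγr : ∀ k, γ k = r k * η k := fun k => by
    have h1 := (hηpos k).ne'
    simp only [hrdef]
    field_simp
  have hrl : ∀ k, r k = 1 - lam * γ k := fun k => by
    have h2 := (hden k).ne'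
    rw [hr', hγk]
    field_simp
    ring
  have hrpos : ∀ k, 0 < r k := fun k => by rw [hr']; have := hden k; positivity
  have hrlt : ∀ k, r k < 1 := fun k => by
    rw [hr', div_lt_one (hden k)]
    have := mul_pos hlam (hηpos k)
    linarith
  have hq : 1 - lam * γ₀ = 1 / (1 + lam * η₀) := by
    have h2 := hden0.ne'
    rw [hγ₀]
    field_simp
    ring
  have hrq : ∀ k, r k ≤ 1 - lam * γ₀ := fun k => by
    rw [hr', hq]
    apply one_div_le_one_div_of_le hden0
    have := mul_le_mul_of_nonneg_left (hηlb k) hlam.le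
    linarith
  have hq0 : 0 < 1 - lam * γ₀ := by rw [hq]; positivity
  have hq1 : 1 - lam * γ₀ < 1 := by
    rw [hq, div_lt_one hden0]
    have := mul_pos hlam hη₀
    linarith
  -- convergence of both paths
  have hwlim : Filter.Tendsto w Filter.atTop (nhds u) := by
    have h := pgd_tendsto T K V hQV hsymQ hsymS hQpos α β η₀ hα hαβ hη₀ η (fun _ => 1) hηlb hηβ
      (fun _ => zero_le_one) (fun _ => le_rfl) hlow hup (fun k => w k - u) (fun k => by
        simp only [hw k, ← hu, map_sub]
        module)
    simpa using h.add_const u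
  have hwhatlim : Filter.Tendsto what Filter.atTop (nhds v) := by
    have h := pgd_tendsto T K V hQV hsymQ hsymS hQpos α β η₀ hα hαβ hη₀ η r hηlb hηβ
      (fun k => (hrpos k).le) (fun k => (hrlt k).le) hlow hup (fun k => what k - v) (fun k => by
        simp only [hwhat k, ← hv, map_sub, map_add, map_smul, hVQ]
        have h1 := hrl k
        rw [hγr k] at h1 ⊢
        generalize V (T (what k)) = x1
        generalize V (T v) = x2
        match_scalars
        · linear_combination -h1
        all_goals first | ring1 | linear_combination h1 | linear_combination -h1)
    simpa using h.add_const v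
  refine ⟨hwlim, hwhatlim, ?_⟩
  -- the averaging identity
  set R : ℕ → ℝ := fun k => ∏ i ∈ Finset.range k, r i with hRdef
  have hR0 : R 0 = 1 := by simp [hRdef]
  have hRs : ∀ k, R (k + 1) = R k * r k := fun k => by simp [hRdef, Finset.prod_range_succ]
  have hPR : ∀ k, P k = 1 - R (k + 1) := hP
  have hpR : ∀ k, p k = R k - R (k + 1) := by
    intro k
    cases k with
    | zero => rw [hp0, hPR, hR0]
    | succ k => rw [hps, hPR, hPR]; ring
  have hid := pgd_identity (V ∘ₗ T) (V a) lam η γ r R hγr hrl hR0 hRs w what hw0 hwhat0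
    (fun k => by rw [hw k, map_sub]; rfl)
    (fun k => by rw [hwhat k, map_sub, map_add, map_smul, hVQ]; rfl)
  have hRpos : ∀ k, 0 < R k := fun k => Finset.prod_pos fun i _ => hrpos i
  have hRle : ∀ k, R k ≤ (1 - lam * γ₀) ^ k := by
    intro k
    induction k with
    | zero => simp [hR0]
    | succ k ih =>
      rw [hRs, pow_succ]
      exact mul_le_mul ih (hrq k) (hrpos k).le (by positivity)
  have hPlow : ∀ k, lam * γ₀ ≤ P k := by
    intro k
    have h1 := hRle (k + 1)
    have h2 : (1 - lam * γ₀) ^ (k + 1) ≤ 1 - lam * γ₀ :=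
      pow_le_of_le_one hq0.le hq1.le (Nat.succ_ne_zero k)
    rw [hPR]
    linarith
  have hc : 0 < lam * γ₀ := by linarith
  have hdiff : ∀ k, what k - wtil k = (R (k + 1) / P k) • (w k - what k) := by
    intro k
    have hPk : P k ≠ 0 := (hc.trans_le (hPlow k)).ne'
    have hsum : ∑ i ∈ Finset.range (k + 1), p i • w i = what k - R (k + 1) • w k := by
      rw [Finset.sum_range_succ, hid k]
      simp only [hpR]
      module
    rw [hwtil, hsum]
    have hRP : R (k + 1) = 1 - P k := by rw [hPR]; ring
    rw [hRP]
    match_scalars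
    · field_simp; ring
    · field_simp
  obtain ⟨B, hB⟩ := (hwlim.sub hwhatlim).norm.bddAbove_range
  refine ⟨(|B| + 1) / (lam * γ₀), by positivity, fun k => ?_⟩
  have hBk : ‖w k - what k‖ ≤ |B| + 1 := by
    have := hB (Set.mem_range_self k)
    have := le_abs_self B
    linarith
  have hPk : 0 < P k := hc.trans_le (hPlow k)
  rw [hdiff, norm_smul, Real.norm_of_nonneg (div_nonneg (hRpos _).le hPk.le)]
  have h1 : R (k + 1) ≤ (1 - lam * γ₀) ^ k := by
    rw [hRs]
    calc R k * r k ≤ R k * 1 := mul_le_mul_of_nonneg_left (hrlt k).le (hRpos k).le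
      _ ≤ _ := by rw [mul_one]; exact hRle k
  calc R (k + 1) / P k * ‖w k - what k‖
      ≤ (1 - lam * γ₀) ^ k / (lam * γ₀) * (|B| + 1) := by
        apply mul_le_mul _ hBk (norm_nonneg _) (by positivity)
        exact div_le_div₀ (by positivity) h1 hc (hPlow k)
    _ = _ := by ring
end

section
/- In the setting of the averaged Nesterov accelerated gradient-descent scheme for the quadratic loss L(w) = ½wᵀΣw − aᵀw with symmetric Σ satisfying αI ⪯ Σ ⪯ βI, 0 < α ≤ β, η ∈ (0, 1/β), γ = η/(1+λη), λ > 0: the sequences w_k and ŵ_k converge as k → ∞, and there exists a constant M > 0 such that for all k ≥ 1, ‖ŵ_k − w̃_k‖₂ ≤ M C^k, where C = (1−√(γ(α+λ)))/(1−√(ηα)) ∈ (0,1). -/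
section NesterovHelpers

variable {E : Type*} [NormedAddCommGroup E] [InnerProductSpace ℝ E]

/-- One step of the Lyapunov decrease for Nesterov acceleration on a quadratic. -/
lemma nesterov_step (T : E →ₗ[ℝ] E) (hT : ∀ x y, inner ℝ (T x) y = inner ℝ x (T y))
    (α β η s τ : ℝ) (hα : 0 < α) (hη : 0 < η) (hηβ : η * β ≤ 1)
    (hlo : ∀ u, α * ‖u‖ ^ 2 ≤ inner ℝ u (T u)) (hup : ∀ u, inner ℝ u (T u) ≤ β * ‖u‖ ^ 2)
    (hs0 : 0 < s) (hs1 : s < 1) (hs : s ^ 2 = η * α) (hτ : τ = (1 - s) / (1 + s))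
    (xp x xn : E) (hxn : xn = (x + τ • (x - xp)) - η • T (x + τ • (x - xp))) :
    inner ℝ xn (T xn) + α * ‖x + s⁻¹ • (xn - x)‖ ^ 2 ≤
      (1 - s) * (inner ℝ x (T x) + α * ‖xp + s⁻¹ • (x - xp)‖ ^ 2) := by
  set y := x + τ • (x - xp) with hy
  set g := T y with hg
  have hτ1 : τ * (1 + s) = 1 - s := by rw [hτ]; field_simp
  have hz : xp + s⁻¹ • (x - xp) = s⁻¹ • ((1 + s) • y - x) := by
    have h1 : xp = x - ((1 + s) / (1 - s)) • (y - x) := by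
      have : ((1 + s) / (1 - s)) • (y - x) = x - xp := by
        rw [hy, add_sub_cancel_left, smul_smul, hτ]
        have : (1 + s) / (1 - s) * ((1 - s) / (1 + s)) = 1 := by
          have : 1 - s ≠ 0 := by linarith
          field_simp
        rw [this, one_smul]
      rw [this]; abel
    have h2 : 1 - s ≠ 0 := by linarith
    rw [h1]
    match_scalars <;> field_simp <;> ring
  have hzn : x + s⁻¹ • (xn - x) = s⁻¹ • (y - (1 - s) • x - η • g) := by
    rw [hxn]
    match_scalars <;> field_simp <;> ring
  have hgy : inner ℝ y (T y) = inner ℝ y g := rfl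
  have hTx : inner ℝ y (T x) = inner ℝ x g := by rw [← hT, real_inner_comm]
  have hTg : inner ℝ y (T g) = ‖g‖ ^ 2 := by rw [← hT, real_inner_self_eq_norm_sq]
  have hgg : inner ℝ g (T y) = ‖g‖ ^ 2 := real_inner_self_eq_norm_sq g
  have hfn : inner ℝ xn (T xn) ≤ inner ℝ y g - η * ‖g‖ ^ 2 := by
    rw [hxn]
    simp only [map_sub, map_smul, inner_sub_left, inner_sub_right, real_inner_smul_left,
      real_inner_smul_right, hTg, hgg, hgy]
    have h1 := hup g
    have h2 : η * (η * inner ℝ g (T g)) ≤ η * (η * (β * ‖g‖ ^ 2)) := by gcongr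
    have h3 : η * ((η * β) * ‖g‖ ^ 2) ≤ η * (1 * ‖g‖ ^ 2) := by gcongr
    linarith
  have hfx := hlo (x - y)
  simp only [map_sub, inner_sub_left, inner_sub_right, hTx] at hfx
  have hfx2 : inner ℝ x (T y) = inner ℝ x g := rfl
  rw [hfx2, hgy, norm_sub_sq_real] at hfx
  have hfy := hlo y
  rw [hgy] at hfy
  rw [hz, hzn, norm_smul, norm_smul, mul_pow, mul_pow]
  have e1 : ‖(1 + s) • y - x‖ ^ 2 =
      (1 + s) ^ 2 * ‖y‖ ^ 2 - 2 * (1 + s) * inner ℝ x y + ‖x‖ ^ 2 := by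
    rw [norm_sub_sq_real, norm_smul, mul_pow, real_inner_smul_left, real_inner_comm]
    simp only [Real.norm_eq_abs, sq_abs]; ring
  have e2 : ‖y - (1 - s) • x - η • g‖ ^ 2 =
      ‖y‖ ^ 2 - 2 * (1 - s) * inner ℝ x y + (1 - s) ^ 2 * ‖x‖ ^ 2
        - 2 * η * (inner ℝ y g - (1 - s) * inner ℝ x g) + η ^ 2 * ‖g‖ ^ 2 := by
    rw [norm_sub_sq_real, norm_sub_sq_real, norm_smul, norm_smul, mul_pow, mul_pow,
      inner_sub_left]
    simp only [real_inner_smul_left, real_inner_smul_right, real_inner_comm x y,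
      Real.norm_eq_abs, sq_abs]
    ring
  rw [e1, e2]
  have hsi : ‖s⁻¹‖ ^ 2 = 1 / (η * α) := by
    rw [Real.norm_eq_abs, sq_abs, inv_pow, hs, one_div]
  have hsi2 : α * (1 / (η * α)) = 1 / η := by field_simp
  rw [hsi, ← mul_assoc, ← mul_assoc, hsi2]
  have hα' : α = s ^ 2 / η := by rw [hs]; field_simp
  rw [hα'] at hfx hfy
  have hN : 0 ≤ ‖x‖ ^ 2 - 2 * inner ℝ x y + ‖y‖ ^ 2 := by
    rw [← norm_sub_sq_real]; positivity
  have hcoef : 0 ≤ (1 - s ^ 2) * s / η := by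
    have : 0 ≤ 1 - s ^ 2 := by nlinarith
    positivity
  have hN2 := mul_nonneg hcoef hN
  have hfx' := mul_le_mul_of_nonneg_left hfx (by linarith : 0 ≤ 1 - s)
  have hfy' := mul_le_mul_of_nonneg_left hfy hs0.le
  have hηi : η * (1 / η) = 1 := by field_simp
  have hmain : 1 / η * (‖y‖ ^ 2 - 2 * (1 - s) * inner ℝ x y + (1 - s) ^ 2 * ‖x‖ ^ 2
        - 2 * η * (inner ℝ y g - (1 - s) * inner ℝ x g) + η ^ 2 * ‖g‖ ^ 2)
      = 1 / η * (‖y‖ ^ 2 - 2 * (1 - s) * inner ℝ x y + (1 - s) ^ 2 * ‖x‖ ^ 2)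
        - 2 * (inner ℝ y g - (1 - s) * inner ℝ x g) + η * ‖g‖ ^ 2 := by
    field_simp
  rw [hmain]
  linear_combination hfn + hfx' + hfy' + hN2

lemma nesterov_summable (T : E →ₗ[ℝ] E) (hT : ∀ x y, inner ℝ (T x) y = inner ℝ x (T y))
    (α β η s τ : ℝ) (hα : 0 < α) (hη : 0 < η) (hηβ : η * β ≤ 1)
    (hlo : ∀ u, α * ‖u‖ ^ 2 ≤ inner ℝ u (T u)) (hup : ∀ u, inner ℝ u (T u) ≤ β * ‖u‖ ^ 2)
    (hs0 : 0 < s) (hs1 : s < 1) (hs : s ^ 2 = η * α) (hτ : τ = (1 - s) / (1 + s))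
    (v : ℕ → E) (hv : ∀ k, v (k + 2) = (v (k + 1) + τ • (v (k + 1) - v k))
      - η • T (v (k + 1) + τ • (v (k + 1) - v k))) :
    Summable (fun k => ‖v k‖) := by
  set V : ℕ → ℝ := fun k => inner ℝ (v (k + 1)) (T (v (k + 1)))
    + α * ‖v k + s⁻¹ • (v (k + 1) - v k)‖ ^ 2 with hV
  have hstep : ∀ k, V (k + 1) ≤ (1 - s) * V k := fun k =>
    nesterov_step T hT α β η s τ hα hη hηβ hlo hup hs0 hs1 hs hτ _ _ _ (hv k)
  have hb : ∀ k, V k ≤ (1 - s) ^ k * V 0 := by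
    intro k
    induction k with
    | zero => simp
    | succ k ih =>
      calc V (k + 1) ≤ (1 - s) * V k := hstep k
        _ ≤ (1 - s) * ((1 - s) ^ k * V 0) := by
          apply mul_le_mul_of_nonneg_left ih; linarith
        _ = _ := by ring
  have hn : ∀ k, ‖v (k + 1)‖ ≤ √(V 0 / α) * √(1 - s) ^ k := by
    intro k
    have h1 : α * ‖v (k + 1)‖ ^ 2 ≤ (1 - s) ^ k * V 0 := by
      refine le_trans (le_trans (hlo _) ?_) (hb k)
      have : 0 ≤ α * ‖v k + s⁻¹ • (v (k + 1) - v k)‖ ^ 2 := by positivity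
      simp only [hV]; linarith
    have h0 : 0 ≤ V 0 := by
      have := hlo (v 1)
      have h3 : 0 ≤ α * ‖v 1‖ ^ 2 := by positivity
      have : 0 ≤ α * ‖v 0 + s⁻¹ • (v (0 + 1) - v 0)‖ ^ 2 := by positivity
      simp only [hV, zero_add] at *; linarith
    apply le_of_sq_le_sq _ (by positivity)
    rw [mul_pow, Real.sq_sqrt (by positivity), ← pow_mul, mul_comm k 2, pow_mul,
      Real.sq_sqrt (by linarith), div_mul_eq_mul_div, le_div_iff₀ hα]
    linarith
  rw [← summable_nat_add_iff 1]
  refine Summable.of_nonneg_of_le (fun _ => norm_nonneg _) hn ?_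
  apply Summable.mul_left
  apply summable_geometric_of_lt_one (Real.sqrt_nonneg _)
  rw [Real.sqrt_lt' one_pos]; linarith

lemma tendsto_of_summable_diff [CompleteSpace E] (w : ℕ → E)
    (h : Summable (fun k => ‖w (k + 1) - w k‖)) :
    ∃ L : E, Filter.Tendsto w Filter.atTop (nhds L) := by
  apply cauchySeq_tendsto_of_complete
  apply cauchySeq_of_summable_dist
  refine h.congr fun k => ?_
  rw [dist_comm, dist_eq_norm]

lemma bounded_of_tendsto (w : ℕ → E) {L : E} (h : Filter.Tendsto w Filter.atTop (nhds L)) :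
    ∃ K, ∀ k, ‖w k‖ ≤ K := by
  obtain ⟨K, hK⟩ := (Metric.isBounded_range_of_tendsto w h).exists_norm_le
  exact ⟨K, fun k => hK _ ⟨k, rfl⟩⟩

end NesterovHelpers

set_option maxHeartbeats 1000000 in
/-- Theorem 4, part 2, expectation form: convergence of the Nesterov accelerated GD
paths, and geometric convergence of the averaged path to the ℓ2-regularized path. -/
theorem averaged_nesterov_gd_convergence
    (d : ℕ) (S : Matrix (Fin d) (Fin d) ℝ)
    (α β : ℝ) (hα : 0 < α) (hαβ : α ≤ β)
    (hlower : (S - α • (1 : Matrix (Fin d) (Fin d) ℝ)).PosSemidef)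
    (hupper : ((β • (1 : Matrix (Fin d) (Fin d) ℝ)) - S).PosSemidef)
    (a : EuclideanSpace ℝ (Fin d)) (lam : ℝ) (hlam : 0 < lam)
    (η γ : ℝ) (hηpos : 0 < η) (hηub : η < 1 / β)
    (hγ : γ = η / (1 + lam * η))
    (τ τhat C : ℝ)
    (hτ : τ = (1 - Real.sqrt (η * α)) / (1 + Real.sqrt (η * α)))
    (hτhat : τhat = (1 - Real.sqrt (γ * (α + lam))) / (1 + Real.sqrt (γ * (α + lam))))
    (hC : C = (1 - Real.sqrt (γ * (α + lam))) / (1 - Real.sqrt (η * α)))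
    (w what : ℕ → EuclideanSpace ℝ (Fin d))
    (hw0 : w 0 = 0) (hw1 : w 1 = 0) (hwhat0 : what 0 = 0) (hwhat1 : what 1 = 0)
    (hw : ∀ k, w (k + 2)
      = (1 + τ) • Matrix.toEuclideanLin
          (1 - η • S) (w (k + 1))
        - τ • Matrix.toEuclideanLin (1 - η • S) (w k) + η • a)
    (hwhat : ∀ k, what (k + 2)
      = (1 + τhat) • Matrix.toEuclideanLin
          (1 - γ • (S + lam • (1 : Matrix (Fin d) (Fin d) ℝ))) (what (k + 1))
        - τhat • Matrix.toEuclideanLin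
            (1 - γ • (S + lam • (1 : Matrix (Fin d) (Fin d) ℝ))) (what k)
        + γ • a)
    (P p : ℕ → ℝ)
    (hP : ∀ k, 1 ≤ k → P k = 1 - (γ / η) * C ^ (k - 1))
    (hp1 : p 1 = P 1) (hps : ∀ k, 1 ≤ k → p (k + 1) = P (k + 1) - P k)
    (wtil : ℕ → EuclideanSpace ℝ (Fin d))
    (hwtil : ∀ k, wtil k = (P k)⁻¹ • ∑ i ∈ Finset.Icc 1 k, p i • w i) :
    0 < C ∧ C < 1 ∧
    (∃ L : EuclideanSpace ℝ (Fin d), Filter.Tendsto w Filter.atTop (nhds L)) ∧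
    (∃ Lhat : EuclideanSpace ℝ (Fin d), Filter.Tendsto what Filter.atTop (nhds Lhat)) ∧
    (∃ M : ℝ, 0 < M ∧ ∀ k, 1 ≤ k → ‖what k - wtil k‖ ≤ M * C ^ k) := by
  have hβ : 0 < β := lt_of_lt_of_le hα hαβ
  have hηβ : η * β < 1 := by rwa [lt_div_iff₀ hβ] at hηub
  have hηα : η * α < 1 := lt_of_le_of_lt (by gcongr) hηβ
  set s := √(η * α) with hsdef
  set t := √(γ * (α + lam)) with htdef
  have hs2 : s ^ 2 = η * α := Real.sq_sqrt (by positivity)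
  have hs0 : 0 < s := Real.sqrt_pos.2 (by positivity)
  have hs1 : s < 1 := by nlinarith
  have hγ0 : 0 < γ := by rw [hγ]; positivity
  have ht2 : t ^ 2 = γ * (α + lam) := Real.sq_sqrt (by positivity)
  have ht0 : 0 < t := Real.sqrt_pos.2 (by positivity)
  obtain ⟨q, hq⟩ : ∃ q, q = γ / η := ⟨_, rfl⟩
  have hq1 : q = 1 - γ * lam := by rw [hq, hγ]; field_simp; ring
  have hqη : γ = q * η := by rw [hq]; field_simp
  have hq0 : 0 < q := by rw [hq]; positivity
  have hqlt : q < 1 := by rw [hq1]; nlinarith [mul_pos hγ0 hlam]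
  have hqt : 1 - t ^ 2 = q * (1 - s ^ 2) := by
    rw [ht2, hs2]; linear_combination (-α) * hqη - hq1
  have hs2lt : 0 < 1 - s ^ 2 := by nlinarith
  have ht1 : t < 1 := by nlinarith [mul_pos hq0 hs2lt]
  have hst : s < t := by nlinarith
  have hC0 : 0 < C := by rw [hC]; apply div_pos <;> linarith
  have hC1 : C < 1 := by rw [hC, div_lt_one (by linarith)]; linarith
  have hCs : C * (1 - s) = 1 - t := by
    rw [hC]; have : 1 - s ≠ 0 := by linarith
    field_simp
  -- coefficient identities
  have hc1 : (1 + τhat) * q = C * (1 + τ) := by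
    have h1 : 1 - s ≠ 0 := by linarith
    have : q = (1 - t ^ 2) / (1 - s ^ 2) := by rw [hqt]; field_simp
    have e : (1 - s ^ 2) = (1 - s) * (1 + s) := by ring
    rw [hτhat, hτ, hC, this, e]
    field_simp
    ring
  have hc2 : τhat * q = C ^ 2 * τ := by
    have h1 : 1 - s ≠ 0 := by linarith
    have : q = (1 - t ^ 2) / (1 - s ^ 2) := by rw [hqt]; field_simp
    have e : (1 - s ^ 2) = (1 - s) * (1 + s) := by ring
    rw [hτhat, hτ, hC, this, e]
    field_simp
    ring
  -- operators
  set A := Matrix.toEuclideanLin (1 - η • S) with hA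
  set T := Matrix.toEuclideanLin S with hTdef
  have hAT : ∀ u, A u = u - η • T u := by
    intro u
    simp [hA, hTdef, Matrix.toLpLin_one]
  have hAh : ∀ u, Matrix.toEuclideanLin
      (1 - γ • (S + lam • (1 : Matrix (Fin d) (Fin d) ℝ))) u = q • A u := by
    intro u
    have : (1 - γ • (S + lam • (1 : Matrix (Fin d) (Fin d) ℝ))) = q • (1 - η • S) := by
      rw [smul_sub, smul_smul, ← hqη, smul_add, smul_smul, hq1, sub_smul, one_smul]
      abel
    rw [this, map_smul]; rfl
  have hSh : S.IsHermitian := by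
    have h1 := hlower.1
    have h2 : (α • (1 : Matrix (Fin d) (Fin d) ℝ)).IsHermitian := by
      simp [Matrix.IsHermitian]
    have := h1.add h2
    simpa using this
  have hTs : ∀ x y, inner ℝ (T x) y = inner ℝ x (T y) :=
    Matrix.isSymmetric_toEuclideanLin_iff.2 hSh
  have hlo : ∀ u, α * ‖u‖ ^ 2 ≤ inner ℝ u (T u) := by
    intro u
    have h := (Matrix.isPositive_toEuclideanLin_iff.2 hlower).2 u
    have e : Matrix.toEuclideanLin (S - α • (1 : Matrix (Fin d) (Fin d) ℝ)) u = T u - α • u := by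
      simp [hTdef, Matrix.toLpLin_one]
    rw [e, inner_sub_left, real_inner_smul_left, real_inner_self_eq_norm_sq, hTs] at h
    simpa using h
  have hup : ∀ u, inner ℝ u (T u) ≤ β * ‖u‖ ^ 2 := by
    intro u
    have h := (Matrix.isPositive_toEuclideanLin_iff.2 hupper).2 u
    have e : Matrix.toEuclideanLin ((β • (1 : Matrix (Fin d) (Fin d) ℝ)) - S) u = β • u - T u := by
      simp [hTdef, Matrix.toLpLin_one]
    rw [e, inner_sub_left, real_inner_smul_left, real_inner_self_eq_norm_sq, hTs] at h
    simpa using h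
  have hwhat' : ∀ k, what (k + 2) = ((1 + τhat) * q) • A (what (k + 1))
      - (τhat * q) • A (what k) + γ • a := by
    intro k
    rw [hwhat k, hAh, hAh, smul_smul, smul_smul]
  clear hwhat hAh
  clear_value A T s t
  have hvr : ∀ k, w (k + 3) - w (k + 2) = (1 + τ) • A (w (k + 2) - w (k + 1))
      - τ • A (w (k + 1) - w k) := by
    intro k
    rw [hw (k + 1), hw k]
    simp only [map_sub]
    module
  have hvhr : ∀ k, what (k + 3) - what (k + 2) = ((1 + τhat) * q) • A (what (k + 2) - what (k + 1))
      - (τhat * q) • A (what (k + 1) - what k) := by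
    intro k
    rw [hwhat' (k + 1), hwhat' k]
    simp only [map_sub]
    module
  have hsum : Summable (fun k => ‖w (k + 1) - w k‖) := by
    refine nesterov_summable T hTs α β η s τ hα hηpos hηβ.le hlo hup hs0 hs1 hs2 hτ
      (fun k => w (k + 1) - w k) ?_
    intro k
    simp only [hvr k, hAT, map_add, map_sub, map_smul]
    module
  have hrel : ∀ k, what (k + 1) - what k = (q / C * C ^ k) • (w (k + 1) - w k) ∧
      what (k + 2) - what (k + 1) = (q / C * C ^ (k + 1)) • (w (k + 2) - w (k + 1)) := by
    intro k
    induction k with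
    | zero =>
      refine ⟨by simp [hw0, hw1, hwhat0, hwhat1], ?_⟩
      have e1 : w 2 = η • a := by rw [hw 0]; simp [hw0, hw1]
      have e2 : what 2 = γ • a := by rw [hwhat' 0]; simp [hwhat0, hwhat1]
      have e3 : q / C * C ^ (0 + 1) * η = γ := by rw [hqη]; field_simp; simp
      simp only [zero_add, e1, e2, hw1, hwhat1, sub_zero, smul_smul] at e3 ⊢
      rw [e3]
    | succ k ih =>
      refine ⟨ih.2, ?_⟩
      rw [hvhr k, hvr k, ih.1, ih.2, hc1, hc2]
      simp only [map_smul]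
      module
  have hhatsum : Summable (fun k => ‖what (k + 1) - what k‖) := by
    refine Summable.of_nonneg_of_le (fun _ => norm_nonneg _) (fun k => ?_) (hsum.mul_left (q / C))
    rw [(hrel k).1, norm_smul, Real.norm_of_nonneg (by positivity)]
    gcongr
    have : C ^ k ≤ 1 := pow_le_one₀ hC0.le hC1.le
    have h3 : 0 < q / C := by positivity
    nlinarith
  obtain ⟨L, hL⟩ := tendsto_of_summable_diff w hsum
  obtain ⟨Lh, hLh⟩ := tendsto_of_summable_diff what hhatsum
  refine ⟨hC0, hC1, ⟨L, hL⟩, ⟨Lh, hLh⟩, ?_⟩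
  obtain ⟨K, hK⟩ := bounded_of_tendsto w hL
  obtain ⟨Kh, hKh⟩ := bounded_of_tendsto what hLh
  have hPs : ∀ k, P (k + 1) = 1 - q * C ^ k := by
    intro k; rw [hP (k + 1) (by omega), hq]; simp
  have hAbel : ∀ k, ∑ i ∈ Finset.Icc 1 (k + 1), p i • w i
      = what (k + 1) - (q * C ^ k) • w (k + 1) := by
    intro k
    induction k with
    | zero => simp [hw1, hwhat1]
    | succ k ih =>
      rw [Finset.sum_Icc_succ_top (by omega), ih, hps (k + 1) (by omega), hPs, hPs]
      have h := (hrel k).2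
      have e : q / C * C ^ (k + 1) = q * C ^ k := by field_simp; ring
      rw [e, sub_eq_iff_eq_add] at h
      rw [show k + 1 + 1 = k + 2 from rfl, h]
      module
  have hK0 : 0 ≤ K := le_trans (norm_nonneg _) (hK 0)
  have hKh0 : 0 ≤ Kh := le_trans (norm_nonneg _) (hKh 0)
  have h1q : 0 < 1 - q := by linarith
  refine ⟨q / C * (K + (1 - q)⁻¹ * (Kh + K)) + 1, by positivity, ?_⟩
  intro k hk
  obtain ⟨k, rfl⟩ : ∃ m, k = m + 1 := ⟨k - 1, by omega⟩
  have hCk : C ^ k ≤ 1 := pow_le_one₀ hC0.le hC1.le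
  have hCk0 : 0 < C ^ k := by positivity
  have hqC : q * C ^ k ≤ q := by nlinarith
  have hPlow : 1 - q ≤ P (k + 1) := by rw [hPs]; linarith
  have hP0 : 0 < P (k + 1) := by linarith
  have hPw : P (k + 1) • wtil (k + 1) = what (k + 1) - (q * C ^ k) • w (k + 1) := by
    rw [hwtil, smul_smul, mul_inv_cancel₀ hP0.ne', one_smul, hAbel]
  have hdiff : what (k + 1) - wtil (k + 1) = (q * C ^ k) • (w (k + 1) - wtil (k + 1)) := by
    rw [hPs] at hPw
    rw [eq_sub_iff_add_eq] at hPw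
    rw [← hPw]; module
  have hwt : ‖wtil (k + 1)‖ ≤ (1 - q)⁻¹ * (Kh + K) := by
    rw [hwtil, hAbel, norm_smul, norm_inv, Real.norm_of_nonneg hP0.le]
    gcongr
    refine (norm_sub_le _ _).trans (add_le_add (hKh _) ?_)
    rw [norm_smul, Real.norm_of_nonneg (by positivity)]
    nlinarith [hK (k + 1), norm_nonneg (w (k + 1))]
  rw [hdiff, norm_smul, Real.norm_of_nonneg (by positivity)]
  have h4 : ‖w (k + 1) - wtil (k + 1)‖ ≤ K + (1 - q)⁻¹ * (Kh + K) :=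
    (norm_sub_le _ _).trans (add_le_add (hK _) hwt)
  calc q * C ^ k * ‖w (k + 1) - wtil (k + 1)‖
      ≤ q * C ^ k * (K + (1 - q)⁻¹ * (Kh + K)) := by gcongr
    _ = q / C * (K + (1 - q)⁻¹ * (Kh + K)) * C ^ (k + 1) := by field_simp; ring
    _ ≤ _ := by
      have : 0 < C ^ (k + 1) := by positivity
      nlinarith
end
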